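/- arXiv:1806.00147 — 2 statements merged into one kernel-verified Lean document; each statement's English description precedes it below -/
import Mathlib

section
/- Let Y be a CAT(1) space with geometric dimension 1 and let A be any subset of Y. Then every path in A of length ≤ π can be straightened to a geodesic arc in A: there is a geodesic arc of Y joining the endpoints of the path whose image is contained in the image of the path (and hence in A). -/
set_option autoImplicit false

noncomputable section

open Set
open scoped ENNReal

universe u

/-- A metric space is CAT(1) iff every pair of points at distance `< π` is joined by
a geodesic, and every geodesic satisfies the spherical comparison inequality for
triangles of perimeter `< 2π` (triangles are at least as thin as their comparison
triangles in the unit sphere `S²`). -/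
def IsCAT1 (Y : Type u) [MetricSpace Y] : Prop :=
  (∀ x y : Y, dist x y < Real.pi → ∃ γ : ℝ → Y,
    γ 0 = x ∧ γ (dist x y) = y ∧
      ∀ s ∈ Set.Icc 0 (dist x y), ∀ t ∈ Set.Icc 0 (dist x y),
        dist (γ s) (γ t) = |s - t|) ∧
  ∀ x y z : Y, ∀ γ : ℝ → Y,
    (γ 0 = x ∧ γ (dist x y) = y ∧
      ∀ s ∈ Set.Icc 0 (dist x y), ∀ t ∈ Set.Icc 0 (dist x y),
        dist (γ s) (γ t) = |s - t|) →
    dist z x + dist z y + dist x y < 2 * Real.pi → 0 < dist x y →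
    ∀ s ∈ Set.Icc 0 (dist x y),
      (Real.sin (dist x y - s) * Real.cos (dist z x) +
        Real.sin s * Real.cos (dist z y)) / Real.sin (dist x y)
        ≤ Real.cos (dist z (γ s))

/-- A distance-type space is "discrete after completion": every Cauchy sequence is
eventually at mutual distance `0`.  For the complete CAT(1) spaces to which this is
applied this is exactly discreteness of the space (resp. of the completion of the
space of geodesic germs, in the case of links). -/
def CauchyDiscrete {α : Type u} (d : α → α → ℝ≥0∞) : Prop :=
  ∀ u : ℕ → α,
    (∀ ε : ℝ≥0∞, 0 < ε → ∃ N : ℕ, ∀ m ≥ N, ∀ n ≥ N, d (u m) (u n) < ε) →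
    ∃ N : ℕ, ∀ m ≥ N, ∀ n ≥ N, d (u m) (u n) = 0

/-- A geodesic germ at `p`: a unit-speed geodesic segment of some positive length
emanating from `p`. -/
def GermSeg {α : Type u} (d : α → α → ℝ≥0∞) (p : α) : Type u :=
  {g : (ℝ → α) × ℝ // 0 < g.2 ∧ g.1 0 = p ∧
    ∀ s ∈ Set.Icc (0:ℝ) g.2, ∀ t ∈ Set.Icc (0:ℝ) g.2,
      d (g.1 s) (g.1 t) = ENNReal.ofReal |s - t|}

/-- The angle of a spherical comparison triangle with side lengths `a`, `b` at the
vertex opposite the side of length `c` (spherical law of cosines). -/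
def sphCompAngle (a b c : ℝ) : ℝ :=
  Real.arccos ((Real.cos c - Real.cos a * Real.cos b) / (Real.sin a * Real.sin b))

/-- The (upper) angle between two geodesic germs at `p`, i.e. the link pseudometric:
the limit (= infimum, by comparison monotonicity in CAT(1) spaces) of spherical
comparison angles. -/
def linkDist {α : Type u} (d : α → α → ℝ≥0∞) (p : α) (g h : GermSeg d p) : ℝ≥0∞ :=
  ENNReal.ofReal
    (⨅ s : Set.Ioc (0:ℝ) (min g.1.2 1), ⨅ t : Set.Ioc (0:ℝ) (min h.1.2 1),
      sphCompAngle s.1 t.1 (d (g.1.1 s.1) (h.1.1 t.1)).toReal)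

/-- Kleiner's geometric dimension: `dimLE 0` means the space is discrete, and
`dimLE (n+1)` means the link of every point (the completion of the space of geodesic
germs at that point, with the angle metric) has dimension at most `n`. -/
def dimLE : ℕ → (α : Type u) → (α → α → ℝ≥0∞) → Prop
  | 0, _, d => CauchyDiscrete d
  | n + 1, α, d => ∀ p : α, dimLE n (GermSeg d p) (linkDist d p)

/-- The geometric dimension equals `n`. -/
def dimEq (n : ℕ) (α : Type u) (d : α → α → ℝ≥0∞) : Prop :=
  dimLE n α d ∧ ∀ m : ℕ, m < n → ¬ dimLE m α d

/-- The cosine of the spherical comparison angle enclosed by the sides `s` and `t`, opposite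
to a side of length `d`. -/
def compCos (s t d : ℝ) : ℝ :=
  (Real.cos d - Real.cos s * Real.cos t) / (Real.sin s * Real.sin t)

theorem sphCompAngle_eq_arccos (s t d : ℝ) : sphCompAngle s t d = Real.arccos (compCos s t d) :=
  rfl

theorem compCos_comm (s t d : ℝ) : compCos s t d = compCos t s d := by
  unfold compCos
  rw [mul_comm (Real.cos s), mul_comm (Real.sin s)]

theorem sin_half_arccos_sq {X : ℝ} (h₁ : -1 ≤ X) (h₂ : X ≤ 1) :
    Real.sin (Real.arccos X / 2) ^ 2 = (1 - X) / 2 := by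
  have h := Real.cos_sq (Real.arccos X / 2)
  rw [mul_div_cancel₀ _ (two_ne_zero' ℝ), Real.cos_arccos h₁ h₂] at h
  have := Real.sin_sq_add_cos_sq (Real.arccos X / 2)
  linarith

theorem sin_half_nonneg {x : ℝ} (h₀ : 0 ≤ x) (h₁ : x ≤ Real.pi) : 0 ≤ Real.sin (x / 2) :=
  Real.sin_nonneg_of_nonneg_of_le_pi (by linarith) (by linarith [Real.pi_pos])

theorem sin_half_le_sin_half {x y : ℝ} (h₀ : 0 ≤ x) (hxy : x ≤ y) (hy : y ≤ Real.pi) :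
    Real.sin (x / 2) ≤ Real.sin (y / 2) :=
  Real.sin_le_sin_of_le_of_le_pi_div_two (by linarith [Real.pi_pos]) (by linarith) (by linarith)

/-- In an isosceles comparison triangle the half-angle at the apex satisfies the law of sines. -/
theorem sin_half_arccos_compCos_self {u d : ℝ} (hu : 0 < u) (hu' : u ≤ 1) (hd : 0 ≤ d)
    (hd' : d ≤ 2 * u) :
    Real.sin (Real.arccos (compCos u u d) / 2) = Real.sin (d / 2) / Real.sin u := by
  have hpi := Real.pi_gt_three
  have hsu : 0 < Real.sin u := Real.sin_pos_of_pos_of_lt_pi hu (by linarith)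
  have hsd : 0 ≤ Real.sin (d / 2) := sin_half_nonneg hd (by linarith)
  have hle : Real.sin (d / 2) ≤ Real.sin u :=
    Real.sin_le_sin_of_le_of_le_pi_div_two (by linarith) (by linarith) (by linarith)
  have hcd : Real.cos d = 1 - 2 * Real.sin (d / 2) ^ 2 := by
    have h := Real.cos_sq (d / 2)
    rw [mul_div_cancel₀ _ (two_ne_zero' ℝ)] at h
    have := Real.sin_sq_add_cos_sq (d / 2)
    linarith
  have hX : compCos u u d = 1 - 2 * (Real.sin (d / 2) / Real.sin u) ^ 2 := by
    unfold compCos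
    rw [hcd]
    have := Real.sin_sq_add_cos_sq u
    field_simp
    linarith
  have h0 : 0 ≤ Real.sin (d / 2) / Real.sin u := by positivity
  have h1 : Real.sin (d / 2) / Real.sin u ≤ 1 := (div_le_one hsu).2 hle
  have hsq := sin_half_arccos_sq (X := compCos u u d) (by rw [hX]; nlinarith)
    (by rw [hX]; nlinarith)
  rw [hX] at hsq ⊢
  refine (pow_left_inj₀ (sin_half_nonneg (Real.arccos_nonneg _) (Real.arccos_le_pi _)) h0
    two_ne_zero).1 ?_
  rw [hsq]
  ring

/-- If the side `e` opposite to the angle is at most the adjacent side `u`, the angle is acute and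
bounded through the law of sines. -/
theorem sin_half_arccos_compCos_sq_le {u r e : ℝ} (hu : 0 < u) (hu' : u ≤ 1) (hr : 0 < r)
    (hr' : r ≤ 1) (he : 0 ≤ e) (heu : e ≤ u) (hur : |u - r| ≤ e) :
    Real.sin (Real.arccos (compCos u r e) / 2) ^ 2 ≤ (Real.sin e / Real.sin u) ^ 2 / 2 := by
  have hpi := Real.pi_gt_three
  have hsu : 0 < Real.sin u := Real.sin_pos_of_pos_of_lt_pi hu (by linarith)
  have hsr : 0 < Real.sin r := Real.sin_pos_of_pos_of_lt_pi hr (by linarith)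
  have hce : Real.cos u ≤ Real.cos e := Real.cos_le_cos_of_nonneg_of_le_pi he (by linarith) heu
  have hcu : 0 ≤ Real.cos u := Real.cos_nonneg_of_neg_pi_div_two_le_of_le (by linarith) (by linarith)
  have hX0 : 0 ≤ compCos u r e := by
    unfold compCos
    refine div_nonneg ?_ (by positivity)
    nlinarith [Real.cos_le_one r]
  have hX1 : compCos u r e ≤ 1 := by
    unfold compCos
    rw [div_le_one (by positivity)]
    have h : Real.cos e ≤ Real.cos (u - r) := by
      rw [← Real.cos_abs (u - r)]
      exact Real.cos_le_cos_of_nonneg_of_le_pi (abs_nonneg _) (by linarith) hur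
    rw [Real.cos_sub] at h
    linarith
  have hX2 : 1 - (Real.sin e / Real.sin u) ^ 2 ≤ compCos u r e ^ 2 := by
    unfold compCos
    rw [div_pow, div_pow, mul_pow, sub_le_iff_le_add, div_add_div _ _ (by positivity) (by positivity),
      le_div_iff₀ (by positivity)]
    have h1 := Real.sin_sq_add_cos_sq u
    have h2 := Real.sin_sq_add_cos_sq r
    have h3 := Real.sin_sq_add_cos_sq e
    have e1 : Real.sin u ^ 2 = 1 - Real.cos u ^ 2 := by linarith
    have e2 : Real.sin r ^ 2 = 1 - Real.cos r ^ 2 := by linarith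
    have e3 : Real.sin e ^ 2 = 1 - Real.cos e ^ 2 := by linarith
    have key : 0 ≤ Real.sin u ^ 2 * (Real.cos e * Real.cos r - Real.cos u) ^ 2 := by positivity
    rw [e1] at key
    rw [e1, e2, e3]
    linarith
  rw [sin_half_arccos_sq (by linarith) hX1]
  nlinarith

section Germs

variable {Y : Type u} [MetricSpace Y]

/-- The geodesic germs of a metric space at a point. -/
abbrev Germ (p : Y) : Type u := GermSeg (fun x y : Y => edist x y) p

namespace Germ

variable {p : Y}

theorem pos (g : Germ p) : 0 < g.1.2 := g.2.1

theorem apply_zero (g : Germ p) : g.1.1 0 = p := g.2.2.1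

theorem dist_apply (g : Germ p) {s t : ℝ} (hs : s ∈ Icc 0 g.1.2) (ht : t ∈ Icc 0 g.1.2) :
    dist (g.1.1 s) (g.1.1 t) = |s - t| := by
  have h : edist (g.1.1 s) (g.1.1 t) = ENNReal.ofReal |s - t| := g.2.2.2 s hs t ht
  rw [dist_edist, h, ENNReal.toReal_ofReal (abs_nonneg _)]

theorem dist_base (g : Germ p) {s : ℝ} (hs : s ∈ Icc 0 g.1.2) : dist p (g.1.1 s) = s := by
  have h := g.dist_apply (s := 0) ⟨le_rfl, g.pos.le⟩ hs
  rwa [g.apply_zero, zero_sub, abs_neg, abs_of_nonneg hs.1] at h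

/-- The germ of a geodesic given by its real distances. -/
def mk (γ : ℝ → Y) (r : ℝ) (hr : 0 < r) (h₀ : γ 0 = p)
    (h : ∀ s ∈ Icc (0 : ℝ) r, ∀ t ∈ Icc (0 : ℝ) r, dist (γ s) (γ t) = |s - t|) : Germ p :=
  ⟨(γ, r), hr, h₀, fun s hs t ht => by simp only [edist_dist, h s hs t ht]⟩

/-- The comparison angle of two germs at the parameters `s` and `t`. -/
def comp (g h : Germ p) (s t : ℝ) : ℝ :=
  Real.arccos (compCos s t (dist (g.1.1 s) (h.1.1 t)))

theorem comp_nonneg (g h : Germ p) (s t : ℝ) : 0 ≤ comp g h s t := Real.arccos_nonneg _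

theorem comp_le_pi (g h : Germ p) (s t : ℝ) : comp g h s t ≤ Real.pi := Real.arccos_le_pi _

theorem comp_comm (g h : Germ p) (s t : ℝ) : comp g h s t = comp h g t s := by
  rw [comp, comp, compCos_comm, dist_comm]

/-- The angle between two germs. -/
def angle (g h : Germ p) : ℝ :=
  ⨅ s : Ioc (0 : ℝ) (min g.1.2 1), ⨅ t : Ioc (0 : ℝ) (min h.1.2 1), comp g h s.1 t.1

theorem linkDist_eq (g h : Germ p) :
    linkDist (fun x y : Y => edist x y) p g h = ENNReal.ofReal (angle g h) := by
  simp only [linkDist, angle, comp, sphCompAngle_eq_arccos, dist_edist]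

instance (g : Germ p) : Nonempty (Ioc (0 : ℝ) (min g.1.2 1)) :=
  ⟨⟨min g.1.2 1, lt_min g.pos one_pos, le_rfl⟩⟩

theorem bddBelow_comp (g h : Germ p) (s : ℝ) :
    BddBelow (range fun t : Ioc (0 : ℝ) (min h.1.2 1) => comp g h s t.1) :=
  ⟨0, by rintro _ ⟨t, rfl⟩; exact comp_nonneg ..⟩

theorem iInf_comp_nonneg (g h : Germ p) (s : ℝ) :
    0 ≤ ⨅ t : Ioc (0 : ℝ) (min h.1.2 1), comp g h s t.1 :=
  le_ciInf fun _ => comp_nonneg ..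

theorem angle_nonneg (g h : Germ p) : 0 ≤ angle g h :=
  le_ciInf fun _ => iInf_comp_nonneg ..

theorem angle_le_comp (g h : Germ p) {s t : ℝ} (hs : s ∈ Ioc 0 (min g.1.2 1))
    (ht : t ∈ Ioc 0 (min h.1.2 1)) : angle g h ≤ comp g h s t :=
  (ciInf_le ⟨0, by rintro _ ⟨s, rfl⟩; exact iInf_comp_nonneg ..⟩ (⟨s, hs⟩ : Ioc _ _)).trans
    (ciInf_le (bddBelow_comp g h s) (⟨t, ht⟩ : Ioc _ _))

theorem angle_le_pi (g h : Germ p) : angle g h ≤ Real.pi :=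
  (angle_le_comp g h ⟨lt_min g.pos one_pos, le_rfl⟩ ⟨lt_min h.pos one_pos, le_rfl⟩).trans
    (comp_le_pi ..)

theorem exists_comp_lt (g h : Germ p) {ε : ℝ} (hε : angle g h < ε) :
    ∃ s ∈ Ioc 0 (min g.1.2 1), ∃ t ∈ Ioc 0 (min h.1.2 1), comp g h s t < ε := by
  obtain ⟨s, hs⟩ := exists_lt_of_ciInf_lt hε
  obtain ⟨t, ht⟩ := exists_lt_of_ciInf_lt hs
  exact ⟨s, s.2, t, t.2, ht⟩

/-- Comparison angles are monotone in the first side. -/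
theorem comp_le_comp_left (hY : IsCAT1 Y) (g h : Germ p) {s' s t : ℝ} (hs' : 0 < s')
    (hs's : s' ≤ s) (hs : s ≤ g.1.2) (ht₀ : 0 < t) (ht : t ≤ h.1.2) (hsp : s < Real.pi)
    (htp : t < Real.pi) (hper : s + t + dist (g.1.1 s) (h.1.1 t) < 2 * Real.pi) :
    comp g h s' t ≤ comp g h s t := by
  have hs0 : 0 < s := hs'.trans_le hs's
  have hd : dist p (g.1.1 s) = s := g.dist_base ⟨hs0.le, hs⟩
  have hdt : dist p (h.1.1 t) = t := h.dist_base ⟨ht₀.le, ht⟩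
  have key := hY.2 p (g.1.1 s) (h.1.1 t) g.1.1
  rw [hd, dist_comm (h.1.1 t) p, hdt, dist_comm (h.1.1 t)] at key
  have key := key ⟨g.apply_zero, rfl, fun a ha b hb =>
    g.dist_apply ⟨ha.1, ha.2.trans hs⟩ ⟨hb.1, hb.2.trans hs⟩⟩ (by linarith) hs0 s' ⟨hs'.le, hs's⟩
  have p1 : 0 < Real.sin s := Real.sin_pos_of_pos_of_lt_pi hs0 hsp
  have p2 : 0 < Real.sin s' := Real.sin_pos_of_pos_of_lt_pi hs' (by linarith)
  have p3 : 0 < Real.sin t := Real.sin_pos_of_pos_of_lt_pi ht₀ htp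
  refine Real.arccos_le_arccos ?_
  unfold compCos
  rw [dist_comm (h.1.1 t), div_le_iff₀ p1, Real.sin_sub] at key
  rw [div_le_div_iff₀ (by positivity) (by positivity)]
  nlinarith

theorem comp_le_comp (hY : IsCAT1 Y) (g h : Germ p) {s' s t' t : ℝ} (hs' : 0 < s')
    (hs's : s' ≤ s) (hs : s ≤ g.1.2) (ht' : 0 < t') (ht't : t' ≤ t) (ht : t ≤ h.1.2)
    (hsp : s < Real.pi) (htp : t < Real.pi)
    (hper : s + t + dist (g.1.1 s) (h.1.1 t) < 2 * Real.pi) :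
    comp g h s' t' ≤ comp g h s t := by
  refine le_trans ?_ (comp_le_comp_left hY g h hs' hs's hs (ht'.trans_le ht't) ht hsp htp hper)
  rw [comp_comm g h s' t', comp_comm g h s' t]
  refine comp_le_comp_left hY h g ht' ht't ht hs' (hs's.trans hs) htp (by linarith) ?_
  have h1 := dist_triangle (h.1.1 t) (g.1.1 s) (g.1.1 s')
  rw [g.dist_apply (s := s) ⟨by linarith, hs⟩ ⟨hs'.le, by linarith⟩, abs_of_nonneg (by linarith),
    dist_comm _ (g.1.1 s)] at h1
  linarith

/-- The normalised chord between two germs at parameter `u`. -/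
def chord (g h : Germ p) (u : ℝ) : ℝ :=
  Real.sin (dist (g.1.1 u) (h.1.1 u) / 2) / Real.sin u

theorem dist_apply_le (g h : Germ p) {u : ℝ} (hu : 0 ≤ u) (hg : u ≤ g.1.2) (hh : u ≤ h.1.2) :
    dist (g.1.1 u) (h.1.1 u) ≤ 2 * u := by
  have := dist_triangle_left (g.1.1 u) (h.1.1 u) p
  rw [g.dist_base ⟨hu, hg⟩, h.dist_base ⟨hu, hh⟩] at this
  linarith

theorem sin_half_comp (g h : Germ p) {u : ℝ} (hu : 0 < u) (hu₁ : u ≤ 1) (hg : u ≤ g.1.2)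
    (hh : u ≤ h.1.2) : Real.sin (comp g h u u / 2) = chord g h u :=
  sin_half_arccos_compCos_self hu hu₁ dist_nonneg (dist_apply_le g h hu.le hg hh)

theorem sin_half_angle_le_chord (g h : Germ p) {u : ℝ} (hu : 0 < u) (hu₁ : u ≤ 1)
    (hg : u ≤ g.1.2) (hh : u ≤ h.1.2) : Real.sin (angle g h / 2) ≤ chord g h u := by
  rw [← sin_half_comp g h hu hu₁ hg hh]
  exact sin_half_le_sin_half (angle_nonneg g h)
    (angle_le_comp g h ⟨hu, le_min hg hu₁⟩ ⟨hu, le_min hh hu₁⟩) (comp_le_pi ..)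

theorem exists_chord_lt (hY : IsCAT1 Y) (g h : Germ p) {c : ℝ}
    (hc : Real.sin (angle g h / 2) < c) :
    ∃ δ : ℝ, 0 < δ ∧ δ ≤ 1 ∧ δ ≤ g.1.2 ∧ δ ≤ h.1.2 ∧ ∀ u, 0 < u → u ≤ δ → chord g h u < c := by
  obtain ⟨s, hs, t, ht, hst⟩ := exists_comp_lt g h
    (ε := angle g h + (c - Real.sin (angle g h / 2))) (by linarith)
  have hpi := Real.pi_gt_three
  have hs1 := hs.2.trans (min_le_right _ _)
  have ht1 := ht.2.trans (min_le_right _ _)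
  have hsg := hs.2.trans (min_le_left _ _)
  have hth := ht.2.trans (min_le_left _ _)
  refine ⟨min s t, lt_min hs.1 ht.1, (min_le_left _ _).trans hs1, (min_le_left _ _).trans hsg,
    (min_le_right _ _).trans hth, fun u hu hu' => ?_⟩
  have hus := hu'.trans (min_le_left _ _)
  have hut := hu'.trans (min_le_right _ _)
  have hper := dist_triangle_left (g.1.1 s) (h.1.1 t) p
  rw [g.dist_base ⟨hs.1.le, hsg⟩, h.dist_base ⟨ht.1.le, hth⟩] at hper
  have h1 := comp_le_comp hY g h hu hus hsg hu hut hth (by linarith) (by linarith) (by linarith)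
  have h0 := angle_le_comp g h (s := u) (t := u) ⟨hu, hus.trans hs.2⟩ ⟨hu, hut.trans ht.2⟩
  rw [← sin_half_comp g h hu (hus.trans hs1) (hus.trans hsg) (hut.trans hth)]
  have h2 : Real.sin (comp g h u u / 2) - Real.sin (angle g h / 2)
      ≤ comp g h u u - angle g h := by
    have h3 := abs_le.1 (Real.abs_sin_sub_sin_le (comp g h u u / 2) (angle g h / 2))
    have h4 : |comp g h u u / 2 - angle g h / 2| ≤ comp g h u u - angle g h := by
      rw [abs_of_nonneg (by linarith)]
      linarith
    linarith
  linarith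

theorem chord_le_add {g h a b c d : Germ p} {u : ℝ} (hu : 0 < u) (hu₁ : u ≤ 1)
    (hg : u ≤ g.1.2) (hh : u ≤ h.1.2) (ha : u ≤ a.1.2) (hb : u ≤ b.1.2)
    (hc : u ≤ c.1.2) (hd : u ≤ d.1.2)
    (H : dist (g.1.1 u) (h.1.1 u) ≤ dist (a.1.1 u) (b.1.1 u) + dist (c.1.1 u) (d.1.1 u)) :
    chord g h u ≤ chord a b u + chord c d u := by
  have hpi := Real.pi_gt_three
  have hsu : 0 < Real.sin u := Real.sin_pos_of_pos_of_lt_pi hu (by linarith)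
  have h1 := dist_apply_le g h hu.le hg hh
  have h2 := dist_apply_le a b hu.le ha hb
  have h3 := dist_apply_le c d hu.le hc hd
  unfold chord
  rw [← add_div]
  gcongr
  have hx0 : 0 ≤ dist (g.1.1 u) (h.1.1 u) := dist_nonneg
  generalize dist (g.1.1 u) (h.1.1 u) = x at *
  have hy0 : 0 ≤ dist (a.1.1 u) (b.1.1 u) := dist_nonneg
  have hz0 : 0 ≤ dist (c.1.1 u) (d.1.1 u) := dist_nonneg
  generalize dist (a.1.1 u) (b.1.1 u) = y at *
  generalize dist (c.1.1 u) (d.1.1 u) = z at *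
  have hy : 0 ≤ Real.sin (y / 2) := sin_half_nonneg hy0 (by linarith)
  have hz : 0 ≤ Real.sin (z / 2) := sin_half_nonneg hz0 (by linarith)
  rcases le_or_gt x y with hxy | hxy
  · have : Real.sin (x / 2) ≤ Real.sin (y / 2) :=
      Real.sin_le_sin_of_le_of_le_pi_div_two (by linarith) (by linarith) (by linarith)
    linarith
  · have e : Real.sin (x / 2) = Real.sin (y / 2) * Real.cos (x / 2 - y / 2)
        + Real.cos (y / 2) * Real.sin (x / 2 - y / 2) := by
      rw [← Real.sin_add]
      ring_nf
    have h4 : 0 ≤ Real.sin (x / 2 - y / 2) :=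
      Real.sin_nonneg_of_nonneg_of_le_pi (by linarith) (by linarith)
    have h5 : Real.sin (x / 2 - y / 2) ≤ Real.sin (z / 2) :=
      Real.sin_le_sin_of_le_of_le_pi_div_two (by linarith) (by linarith) (by linarith)
    rw [e]
    nlinarith [Real.cos_le_one (x / 2 - y / 2), Real.cos_le_one (y / 2)]

/-- An inequality between chords passes to the limiting angles. -/
theorem sin_half_angle_le_add (hY : IsCAT1 Y) {g h a b c d : Germ p}
    (H : ∀ u, dist (g.1.1 u) (h.1.1 u) ≤ dist (a.1.1 u) (b.1.1 u) + dist (c.1.1 u) (d.1.1 u)) :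
    Real.sin (angle g h / 2) ≤ Real.sin (angle a b / 2) + Real.sin (angle c d / 2) := by
  refine le_of_forall_pos_le_add fun ε hε => ?_
  obtain ⟨δ, hδ, hδ1, hδa, hδb, H1⟩ := exists_chord_lt hY a b
    (c := Real.sin (angle a b / 2) + ε / 2) (by linarith)
  obtain ⟨η, hη, hη1, hηc, hηd, H2⟩ := exists_chord_lt hY c d
    (c := Real.sin (angle c d / 2) + ε / 2) (by linarith)
  obtain ⟨u, hu, hu'⟩ := exists_between (lt_min (lt_min hδ hη) (lt_min g.pos h.pos))
  simp only [lt_min_iff] at hu'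
  obtain ⟨⟨h1, h2⟩, h3, h4⟩ := hu'
  have k1 := H1 u hu h1.le
  have k2 := H2 u hu h2.le
  have k3 := sin_half_angle_le_chord g h hu (by linarith) h3.le h4.le
  have k4 := chord_le_add (g := g) (h := h) (a := a) (b := b) (c := c) (d := d) hu (by linarith)
    h3.le h4.le (by linarith) (by linarith) (by linarith) (by linarith) (H u)
  linarith

/-- Approximate midpoints in the space of germs. -/
theorem exists_midpoint (hY : IsCAT1 Y) (g h : Germ p) (h₀ : 0 < Real.sin (angle g h / 2))
    (h₁ : Real.sin (angle g h / 2) < 1) :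
    ∃ k : Germ p, 0 < Real.sin (angle g k / 2) ∧
      Real.sin (angle g k / 2) ≤ 4 / 5 * Real.sin (angle g h / 2) := by
  have hpi := Real.pi_gt_three
  obtain ⟨δ, hδ, hδ1, hδg, hδh, H⟩ := exists_chord_lt hY g h
    (c := min 1 (11 / 10 * Real.sin (angle g h / 2))) (lt_min h₁ (by linarith))
  set u := δ / 2 with hu_def
  have hu : 0 < u := by positivity
  have hu1 : u ≤ 1 / 2 := by linarith
  have hug : u ≤ g.1.2 := by linarith
  have huh : u ≤ h.1.2 := by linarith
  have hch := H u hu (by linarith)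
  rw [lt_min_iff] at hch
  have hsu : 0 < Real.sin u := Real.sin_pos_of_pos_of_lt_pi hu (by linarith)
  have hdle := dist_apply_le g h hu.le hug huh
  set d := dist (g.1.1 u) (h.1.1 u) with hd
  have hd0 : 0 ≤ d := dist_nonneg
  have hdlt : d < 2 * u := by
    refine lt_of_le_of_ne hdle fun heq => ?_
    have h2 := hch.1
    rw [chord, ← hd, heq, mul_div_cancel_left₀ _ (two_ne_zero' ℝ), div_self hsu.ne'] at h2
    exact lt_irrefl _ h2
  obtain ⟨γ, hγ0, hγ1, hγ⟩ := hY.1 (g.1.1 u) (h.1.1 u) (by linarith)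
  rw [← hd] at hγ1 hγ
  set m := γ (d / 2) with hm
  have hmg : dist (g.1.1 u) m = d / 2 := by
    rw [← hγ0, hγ 0 ⟨le_rfl, hd0⟩ _ ⟨by linarith, by linarith⟩, zero_sub, abs_neg,
      abs_of_nonneg (by linarith)]
  have hmh : dist (h.1.1 u) m = d / 2 := by
    rw [← hγ1, hγ d ⟨hd0, le_rfl⟩ _ ⟨by linarith, by linarith⟩, abs_of_nonneg (by linarith)]
    ring
  have hpg := g.dist_base ⟨hu.le, hug⟩
  have hph := h.dist_base ⟨hu.le, huh⟩
  have t1 := dist_triangle_right p (g.1.1 u) m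
  have t2 := dist_triangle p (g.1.1 u) m
  have t3 := dist_triangle_right p (h.1.1 u) m
  have t4 := dist_triangle p (h.1.1 u) m
  set r := dist p m with hr
  have hr0 : 0 < r := by linarith
  have hr1 : r ≤ 1 := by linarith
  obtain ⟨κ, hκ0, hκ1, hκ⟩ := hY.1 p m (by linarith)
  rw [← hr] at hκ1 hκ
  let k : Germ p := mk κ r hr0 hκ0 hκ
  have bound : ∀ a : Germ p, u ≤ a.1.2 → dist (a.1.1 u) m = d / 2 → |u - r| ≤ d / 2 →
      Real.sin (angle a k / 2) ^ 2 ≤ chord g h u ^ 2 / 2 := by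
    intro a ha ham hur
    have hle : angle a k ≤ comp a k u r :=
      angle_le_comp a k ⟨hu, le_min ha (by linarith)⟩ ⟨hr0, le_min le_rfl hr1⟩
    have hsin := sin_half_le_sin_half (angle_nonneg a k) hle (comp_le_pi ..)
    have hc : comp a k u r = Real.arccos (compCos u r (d / 2)) := by
      have hk : k.1.1 r = m := hκ1
      rw [comp, hk, ham]
    refine (pow_le_pow_left₀ (sin_half_nonneg (angle_nonneg a k) (angle_le_pi a k)) hsin 2).trans ?_
    rw [hc]
    exact sin_half_arccos_compCos_sq_le hu (by linarith) hr0 hr1 (by linarith) (by linarith) hur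
  have bound' : ∀ a : Germ p, u ≤ a.1.2 → dist (a.1.1 u) m = d / 2 → |u - r| ≤ d / 2 →
      Real.sin (angle a k / 2) ≤ 4 / 5 * Real.sin (angle g h / 2) := by
    intro a ha ham hur
    have h1 := bound a ha ham hur
    have h3 : 0 ≤ chord g h u :=
      h₀.le.trans (sin_half_angle_le_chord g h hu (by linarith) hug huh)
    have h2 : chord g h u ^ 2 ≤ (11 / 10 * Real.sin (angle g h / 2)) ^ 2 :=
      pow_le_pow_left₀ h3 hch.2.le 2
    refine le_of_sq_le_sq ?_ (by positivity)
    nlinarith [sq_nonneg (Real.sin (angle g h / 2))]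
  have hur : |u - r| ≤ d / 2 := abs_le.2 ⟨by linarith, by linarith⟩
  have b1 := bound' g hug hmg hur
  have b2 := bound' h huh hmh hur
  refine ⟨k, ?_, b1⟩
  have h3 := sin_half_angle_le_add hY (g := g) (h := h) (a := g) (b := k) (c := h) (d := k)
    fun v => dist_triangle_right _ _ _
  linarith

/-- In a space of dimension at most one, non-opposite germs enclose the angle zero. -/
theorem sin_half_angle_eq_zero (hY : IsCAT1 Y)
    (hdim : CauchyDiscrete (linkDist (fun x y : Y => edist x y) p)) (g h : Germ p)
    (h₁ : Real.sin (angle g h / 2) < 1) : Real.sin (angle g h / 2) = 0 := by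
  have hpi := Real.pi_gt_three
  have nn : ∀ a b : Germ p, 0 ≤ Real.sin (angle a b / 2) := fun a b =>
    sin_half_nonneg (angle_nonneg a b) (angle_le_pi a b)
  by_contra hne
  have h₀ : 0 < Real.sin (angle g h / 2) := lt_of_le_of_ne (nn g h) (Ne.symm hne)
  let P : Germ p → Prop := fun k => 0 < Real.sin (angle g k / 2) ∧ Real.sin (angle g k / 2) < 1
  have step : ∀ k : {k // P k}, ∃ l : {k // P k},
      Real.sin (angle g l.1 / 2) ≤ 4 / 5 * Real.sin (angle g k.1 / 2) := by
    rintro ⟨k, hk0, hk1⟩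
    obtain ⟨l, hl0, hl⟩ := exists_midpoint hY g k hk0 hk1
    exact ⟨⟨l, hl0, by linarith⟩, hl⟩
  choose F hF using step
  let v : ℕ → {k // P k} := fun n => F^[n] ⟨h, h₀, h₁⟩
  have hv : ∀ n, Real.sin (angle g (v n).1 / 2) ≤ (4 / 5) ^ n := by
    intro n
    induction n with
    | zero => exact h₁.le.trans (pow_zero _).ge
    | succ n ih =>
      have h2 := hF (v n)
      have h3 : v (n + 1) = F (v n) := Function.iterate_succ_apply' F n _
      rw [h3, pow_succ]
      linarith
  have small : ∀ ε : ℝ, 0 < ε → ∃ N : ℕ, ∀ n ≥ N, Real.sin (angle g (v n).1 / 2) < ε := by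
    intro ε hε
    obtain ⟨N, hN⟩ := exists_pow_lt_of_lt_one hε (show (4 / 5 : ℝ) < 1 by norm_num)
    refine ⟨N, fun n hn => (hv n).trans_lt (lt_of_le_of_lt ?_ hN)⟩
    exact pow_le_pow_of_le_one (by norm_num) (by norm_num) hn
  obtain ⟨N, hN⟩ := hdim (fun n => (v n).1) (by
    intro ε hε
    obtain ⟨η, hη, hηε⟩ : ∃ η : ℝ, 0 < η ∧ ENNReal.ofReal η < ε := by
      obtain ⟨q, hq, hqε⟩ := ENNReal.lt_iff_exists_nnreal_btwn.1 hε
      exact ⟨q, by exact_mod_cast hq, by rwa [ENNReal.ofReal_coe_nnreal]⟩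
    obtain ⟨N, hN⟩ := small (η / (2 * Real.pi)) (by positivity)
    refine ⟨N, fun m hm n hn => lt_of_le_of_lt ?_ hηε⟩
    rw [linkDist_eq]
    refine ENNReal.ofReal_le_ofReal ?_
    have h1 := sin_half_angle_le_add hY (g := (v m).1) (h := (v n).1) (a := g) (b := (v m).1)
      (c := g) (d := (v n).1) fun w => dist_triangle_left _ _ _
    have h2 := Real.mul_le_sin (x := angle (v m).1 (v n).1 / 2)
      (by linarith [angle_nonneg (v m).1 (v n).1])
      (by linarith [angle_le_pi (v m).1 (v n).1])
    have h3 := hN m hm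
    have h4 := hN n hn
    have h5 : 2 / Real.pi * (angle (v m).1 (v n).1 / 2) < η / (2 * Real.pi) + η / (2 * Real.pi) := by
      linarith
    have h6 : angle (v m).1 (v n).1 / Real.pi < η / Real.pi := by
      calc angle (v m).1 (v n).1 / Real.pi
          = 2 / Real.pi * (angle (v m).1 (v n).1 / 2) := by ring
        _ < _ := h5
        _ = η / Real.pi := by field_simp; norm_num
    exact ((div_lt_div_iff_of_pos_right Real.pi_pos).1 h6).le)
  obtain ⟨M, hM⟩ := small _ (v N).2.1
  have h1 := hM (max M N) (le_max_left _ _)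
  have h2 := hN (max M N) (le_max_right _ _) N le_rfl
  rw [linkDist_eq, ENNReal.ofReal_eq_zero] at h2
  have h3 : angle (v (max M N)).1 (v N).1 = 0 := le_antisymm h2 (angle_nonneg _ _)
  have h4 := sin_half_angle_le_add hY (g := g) (h := (v N).1) (a := g) (b := (v (max M N)).1)
    (c := (v (max M N)).1) (d := (v N).1) fun w => dist_triangle _ _ _
  rw [h3, zero_div, Real.sin_zero] at h4
  linarith

end Germ

theorem cos_lt_cos_of_lt_of_add_lt {x y : ℝ} (hxy : x < y) (h₀ : 0 ≤ x)
    (h : x + y < 2 * Real.pi) : Real.cos y < Real.cos x := by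
  have e := Real.cos_sub_cos x y
  have h1 : 0 < Real.sin ((x + y) / 2) := Real.sin_pos_of_pos_of_lt_pi (by linarith) (by linarith)
  have h2 : 0 < Real.sin ((y - x) / 2) := Real.sin_pos_of_pos_of_lt_pi (by linarith) (by linarith)
  have h3 : Real.sin ((x - y) / 2) = -Real.sin ((y - x) / 2) := by
    rw [← Real.sin_neg]
    ring_nf
  rw [h3] at e
  nlinarith

/-- A geodesic between points at distance less than `π` defines a germ. -/
theorem exists_germ (hY : IsCAT1 Y) {y x : Y} (hne : y ≠ x) (hlt : dist y x < Real.pi) :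
    ∃ g : Germ y, g.1.2 = dist y x ∧ g.1.1 (dist y x) = x := by
  obtain ⟨γ, h0, h1, h⟩ := hY.1 y x hlt
  exact ⟨Germ.mk γ (dist y x) (dist_pos.2 hne) h0 h, rfl, h1⟩

theorem sin_half_angle_lt_one (hY : IsCAT1 Y) {y x q : Y} (g h : Germ y)
    (hg : g.1.2 = dist y x) (hgx : g.1.1 (dist y x) = x) (hh : h.1.2 = dist y q)
    (hhq : h.1.1 (dist y q) = q) (hx : dist y x < Real.pi) (hq : dist y q < Real.pi)
    (hper : dist y x + dist y q + dist x q < 2 * Real.pi)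
    (hlt : dist x q < dist y x + dist y q) : Real.sin (Germ.angle g h / 2) < 1 := by
  have hpi := Real.pi_gt_three
  have hx0 : 0 < dist y x := hg ▸ g.pos
  have hq0 : 0 < dist y q := hh ▸ h.pos
  have p1 := Real.sin_pos_of_pos_of_lt_pi hx0 hx
  have p2 := Real.sin_pos_of_pos_of_lt_pi hq0 hq
  have hcomp : Germ.comp g h (dist y x) (dist y q) < Real.pi := by
    rw [Germ.comp, hgx, hhq, Real.arccos_lt_pi, compCos, lt_div_iff₀ (by positivity)]
    have := cos_lt_cos_of_lt_of_add_lt hlt dist_nonneg (by linarith)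
    rw [Real.cos_add] at this
    linarith
  have hmg : 0 < min g.1.2 1 := lt_min g.pos one_pos
  have hmh : 0 < min h.1.2 1 := lt_min h.pos one_pos
  have h1 : Germ.angle g h ≤ Germ.comp g h (dist y x) (dist y q) :=
    (Germ.angle_le_comp g h ⟨hmg, le_rfl⟩ ⟨hmh, le_rfl⟩).trans
      (Germ.comp_le_comp hY g h hmg ((min_le_left _ _).trans hg.le) hg.ge hmh
        ((min_le_left _ _).trans hh.le) hh.ge hx hq (by rw [hgx, hhq]; exact hper))
  have h0 := Germ.angle_nonneg g h
  rw [← Real.sin_pi_div_two]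
  exact Real.sin_lt_sin_of_lt_of_le_pi_div_two (by linarith) le_rfl (by linarith)

/-- In a one-dimensional CAT(1) space each side of a short triangle is contained in the union of
the other two. -/
theorem between_or_between (hY : IsCAT1 Y)
    (hdim : ∀ y : Y, CauchyDiscrete (linkDist (fun x y : Y => edist x y) y)) {x y z q : Y}
    (hxyz : dist x y + dist y z = dist x z)
    (hper : dist q x + dist q z + dist x z < 2 * Real.pi) :
    dist x y + dist y q = dist x q ∨ dist z y + dist y q = dist z q := by
  by_contra hcon
  rw [not_or] at hcon
  obtain ⟨c1, c2⟩ := hcon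
  have hyx : y ≠ x := by rintro rfl; simp at c1
  have hyz : y ≠ z := by rintro rfl; simp at c2
  have hyq : y ≠ q := by rintro rfl; simp at c1
  have l1 : dist x q < dist y x + dist y q := by
    rw [dist_comm y x]
    exact lt_of_le_of_ne (dist_triangle _ _ _) (Ne.symm c1)
  have l2 : dist z q < dist y z + dist y q := by
    rw [dist_comm y z]
    exact lt_of_le_of_ne (dist_triangle _ _ _) (Ne.symm c2)
  rw [dist_comm x y] at hxyz
  rw [dist_comm q x, dist_comm q z] at hper
  have t1 := dist_triangle y x q
  have t2 := dist_triangle y z q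
  have t3 := dist_triangle_right x z q
  have px := dist_pos.2 hyx
  have pz := dist_pos.2 hyz
  obtain ⟨a, ha, hax⟩ := exists_germ hY hyx (by linarith)
  obtain ⟨b, hb, hbz⟩ := exists_germ hY hyz (by linarith)
  obtain ⟨c, hc, hcq⟩ := exists_germ hY hyq (by linarith)
  have s1 := Germ.sin_half_angle_eq_zero hY (hdim y) a c
    (sin_half_angle_lt_one hY a c ha hax hc hcq (by linarith) (by linarith) (by linarith) l1)
  have s2 := Germ.sin_half_angle_eq_zero hY (hdim y) b c
    (sin_half_angle_lt_one hY b c hb hbz hc hcq (by linarith) (by linarith) (by linarith) l2)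
  have s3 := Germ.sin_half_angle_le_add hY (g := a) (h := b) (a := a) (b := c) (c := b) (d := c)
    fun v => dist_triangle_right _ _ _
  obtain ⟨δ, hδ, hδ1, hδa, hδb, H⟩ := Germ.exists_chord_lt hY a b (c := 1) (by linarith)
  have hlt := H δ hδ le_rfl
  have hsδ : 0 < Real.sin δ :=
    Real.sin_pos_of_pos_of_lt_pi hδ (by linarith [Real.pi_gt_three])
  have hdx := a.dist_apply (s := δ) (t := dist y x) ⟨hδ.le, hδa⟩ ⟨dist_nonneg, ha.ge⟩
  have hdz := b.dist_apply (s := δ) (t := dist y z) ⟨hδ.le, hδb⟩ ⟨dist_nonneg, hb.ge⟩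
  rw [hax, abs_sub_comm, abs_of_nonneg (by linarith)] at hdx
  rw [hbz, abs_sub_comm, abs_of_nonneg (by linarith)] at hdz
  have t4 := dist_triangle4_left (a.1.1 δ) x z (b.1.1 δ)
  have t5 := dist_triangle4 x (a.1.1 δ) (b.1.1 δ) z
  rw [dist_comm x (a.1.1 δ)] at t5
  have hle := Germ.dist_apply_le a b hδ.le hδa hδb
  have heq : dist (a.1.1 δ) (b.1.1 δ) = 2 * δ := by linarith
  rw [Germ.chord, heq, mul_div_cancel_left₀ _ (two_ne_zero' ℝ), div_self hsδ.ne'] at hlt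
  exact lt_irrefl _ hlt

theorem dist_add_dist_add_dist_le_of_eVariationOn_le {f : ℝ → Y} {a b L : ℝ} (hL : 0 ≤ L)
    (hlen : eVariationOn f (Icc a b) ≤ ENNReal.ofReal L) {s t : ℝ} (has : a ≤ s) (hst : s ≤ t)
    (htb : t ≤ b) : dist (f a) (f s) + dist (f s) (f t) + dist (f t) (f b) ≤ L := by
  have ha : a ∈ Icc a b := ⟨le_rfl, by linarith⟩
  have hb : b ∈ Icc a b := ⟨by linarith, le_rfl⟩
  have hs : s ∈ Icc a b := ⟨has, by linarith⟩
  have ht : t ∈ Icc a b := ⟨by linarith, htb⟩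
  have e1 := eVariationOn.Icc_add_Icc f (s := Icc a b) has (hst.trans htb) hs
  have e2 := eVariationOn.Icc_add_Icc f (s := Icc a b) hst htb ht
  rw [← e2] at e1
  simp only [inter_self] at e1
  have sub : ∀ {c d : ℝ}, c ≤ d → c ∈ Icc a b → d ∈ Icc a b →
      edist (f c) (f d) ≤ eVariationOn f (Icc a b ∩ Icc c d) := fun hcd hc hd =>
    eVariationOn.edist_le f ⟨hc, le_rfl, hcd⟩ ⟨hd, hcd, le_rfl⟩
  have key : edist (f a) (f s) + (edist (f s) (f t) + edist (f t) (f b)) ≤ ENNReal.ofReal L :=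
    (add_le_add (sub has ha hs) (add_le_add (sub hst hs ht) (sub htb ht hb))).trans
      (e1.le.trans hlen)
  simp only [edist_dist] at key
  rw [← ENNReal.ofReal_add dist_nonneg dist_nonneg,
    ← ENNReal.ofReal_add dist_nonneg (by positivity), ENNReal.ofReal_le_ofReal_iff hL] at key
  linarith

/-- A path whose length is the distance of its endpoints runs along a geodesic. -/
theorem exists_geodesic_of_eVariationOn_le_dist {f : ℝ → Y} {a b : ℝ} (hab : a ≤ b)
    (hcont : ContinuousOn f (Icc a b))
    (hlen : eVariationOn f (Icc a b) ≤ ENNReal.ofReal (dist (f a) (f b))) :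
    ∃ γ : ℝ → Y, γ 0 = f a ∧ γ (dist (f a) (f b)) = f b ∧
      (∀ s ∈ Icc 0 (dist (f a) (f b)), ∀ t ∈ Icc 0 (dist (f a) (f b)),
        dist (γ s) (γ t) = |s - t|) ∧
      γ '' Icc 0 (dist (f a) (f b)) ⊆ f '' Icc a b := by
  have hφ : ContinuousOn (fun t => dist (f a) (f t)) (Icc a b) := by fun_prop
  have hiv : ∀ r, ∃ t, r ∈ Icc 0 (dist (f a) (f b)) → t ∈ Icc a b ∧ dist (f a) (f t) = r := by
    intro r
    by_cases hr : r ∈ Icc 0 (dist (f a) (f b))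
    · have h := intermediate_value_Icc hab hφ
      rw [dist_self] at h
      obtain ⟨t, ht, htr⟩ := h hr
      exact ⟨t, fun _ => ⟨ht, htr⟩⟩
    · exact ⟨0, fun h => absurd h hr⟩
  choose τ hτ using hiv
  have mono : ∀ {s t : ℝ}, a ≤ s → s ≤ t → t ≤ b →
      dist (f s) (f t) = dist (f a) (f t) - dist (f a) (f s) := by
    intro s t has hst htb
    have h1 := dist_add_dist_add_dist_le_of_eVariationOn_le dist_nonneg hlen has hst htb
    have h2 := dist_triangle (f a) (f t) (f b)
    have h3 := dist_triangle (f a) (f s) (f t)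
    linarith
  have h0 : (0 : ℝ) ∈ Icc 0 (dist (f a) (f b)) := ⟨le_rfl, dist_nonneg⟩
  have hL : dist (f a) (f b) ∈ Icc 0 (dist (f a) (f b)) := ⟨dist_nonneg, le_rfl⟩
  refine ⟨fun r => f (τ r), (dist_eq_zero.1 (hτ 0 h0).2).symm, ?_, ?_, ?_⟩
  · obtain ⟨h1, h2⟩ := hτ _ hL
    have h3 := mono h1.1 h1.2 le_rfl
    rw [h2, sub_self] at h3
    exact dist_eq_zero.1 h3
  · intro s hs t ht
    obtain ⟨s1, s2⟩ := hτ s hs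
    obtain ⟨t1, t2⟩ := hτ t ht
    rcases le_total (τ s) (τ t) with h | h
    · have h3 := mono s1.1 h t1.2
      rw [s2, t2] at h3
      have h4 : 0 ≤ t - s := h3 ▸ dist_nonneg
      rw [abs_sub_comm, abs_of_nonneg h4, h3]
    · have h3 := mono t1.1 h s1.2
      rw [s2, t2] at h3
      have h4 : 0 ≤ s - t := h3 ▸ dist_nonneg
      rw [abs_of_nonneg h4, dist_comm, h3]
  · rintro _ ⟨r, hr, rfl⟩
    exact ⟨τ r, (hτ r hr).1, rfl⟩

/-- In a one-dimensional CAT(1) space a path which stays at distance less than `π` from its initial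
point passes through every point between its endpoints. -/
theorem mem_image_of_between (hY : IsCAT1 Y)
    (hdim : ∀ y : Y, CauchyDiscrete (linkDist (fun x y : Y => edist x y) y)) {f : ℝ → Y}
    {a b : ℝ} (hab : a ≤ b) (hcont : ContinuousOn f (Icc a b))
    (hlt : ∀ t ∈ Icc a b, dist (f a) (f t) < Real.pi) {y : Y}
    (hy : dist (f a) y + dist y (f b) = dist (f a) (f b)) : y ∈ f '' Icc a b := by
  by_contra hmem
  have hne : ∀ t ∈ Icc a b, y ≠ f t := fun t ht h => hmem ⟨t, ht, h.symm⟩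
  have : PreconnectedSpace (Icc a b) := Subtype.preconnectedSpace isPreconnected_Icc
  let F : Icc a b → Y := fun t => f t
  have hF : Continuous F := continuousOn_iff_continuous_domRestrict.1 hcont
  let C : Set (Icc a b) := {t | dist (f a) y + dist y (F t) = dist (f a) (F t)}
  have hclosed : IsClosed C := isClosed_eq (by fun_prop) (by fun_prop)
  have hopen : IsOpen C := by
    rw [isOpen_iff_mem_nhds]
    intro t ht
    have e1 : ∀ᶠ s in nhds t, dist (F t) (F s) < dist y (F t) :=
      (show Continuous fun s => dist (F t) (F s) by fun_prop).continuousAt.eventually_lt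
        continuousAt_const (by simpa using dist_pos.2 (hne t t.2))
    have e2 : ∀ᶠ s in nhds t, dist (F t) (F s) < Real.pi - dist (f a) (F t) :=
      (show Continuous fun s => dist (F t) (F s) by fun_prop).continuousAt.eventually_lt
        continuousAt_const (by simpa using hlt t t.2)
    filter_upwards [e1, e2] with s h1 h2
    have h3 := dist_triangle (f a) (F t) (F s)
    have hbt := between_or_between hY hdim (x := f a) (y := y) (z := F t) (q := F s) ht
      (by rw [dist_comm (F s) (f a), dist_comm (F s) (F t)]; linarith)
    refine hbt.resolve_right fun h4 => ?_
    have h5 : 0 ≤ dist y (F s) := dist_nonneg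
    rw [dist_comm (F t) y] at h4
    linarith
  have huniv : C = univ := IsClopen.eq_univ ⟨hclosed, hopen⟩ ⟨⟨b, hab, le_rfl⟩, hy⟩
  have ha : (⟨a, le_rfl, hab⟩ : Icc a b) ∈ C := huniv ▸ mem_univ _
  have ha' : dist (f a) y + dist y (f a) = dist (f a) (f a) := ha
  rw [dist_self, dist_comm y] at ha'
  have h0 : dist (f a) y = 0 := by linarith
  exact hne a ⟨le_rfl, hab⟩ (dist_eq_zero.1 h0).symm

end Germs

/-- straightening short paths.  Let `Y` be a CAT(1) space of
geometric dimension one and let `A ⊆ Y`.  Every (continuous) path in `A` of length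
`≤ π` can be straightened to a geodesic arc in `A`: there is a geodesic arc of `Y`
joining the endpoints of the path whose image is contained in the image of the path
(hence in `A`). -/
theorem short_paths_straighten
    {Y : Type u} [MetricSpace Y] (hY : IsCAT1 Y)
    (hdim : dimEq 1 Y (fun x y : Y => edist x y))
    (A : Set Y) (f : ℝ → Y) (a b : ℝ) (hab : a ≤ b)
    (hcont : ContinuousOn f (Set.Icc a b))
    (hfA : f '' Set.Icc a b ⊆ A)
    (hlen : eVariationOn f (Set.Icc a b) ≤ ENNReal.ofReal Real.pi) :
    ∃ γ : ℝ → Y, γ 0 = f a ∧ γ (dist (f a) (f b)) = f b ∧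
      (∀ s ∈ Set.Icc 0 (dist (f a) (f b)), ∀ t ∈ Set.Icc 0 (dist (f a) (f b)),
        dist (γ s) (γ t) = |s - t|) ∧
      γ '' Set.Icc 0 (dist (f a) (f b)) ⊆ f '' Set.Icc a b ∧
      γ '' Set.Icc 0 (dist (f a) (f b)) ⊆ A := by
  have hd : ∀ y : Y, CauchyDiscrete (linkDist (fun x y : Y => edist x y) y) := hdim.1
  suffices h : ∃ γ : ℝ → Y, γ 0 = f a ∧ γ (dist (f a) (f b)) = f b ∧
      (∀ s ∈ Set.Icc 0 (dist (f a) (f b)), ∀ t ∈ Set.Icc 0 (dist (f a) (f b)),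
        dist (γ s) (γ t) = |s - t|) ∧
      γ '' Set.Icc 0 (dist (f a) (f b)) ⊆ f '' Set.Icc a b by
    obtain ⟨γ, h0, h1, h2, h3⟩ := h
    exact ⟨γ, h0, h1, h2, h3, h3.trans hfA⟩
  have len : ∀ t ∈ Icc a b, dist (f a) (f t) + dist (f t) (f b) ≤ Real.pi := by
    intro t ht
    have h := dist_add_dist_add_dist_le_of_eVariationOn_le Real.pi_pos.le hlen ht.1 le_rfl ht.2
    rwa [dist_self, add_zero] at h
  have hle := len b ⟨hab, le_rfl⟩
  rw [dist_self, add_zero] at hle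
  rcases hle.eq_or_lt with heq | hlt
  · exact exists_geodesic_of_eVariationOn_le_dist hab hcont (by rwa [heq])
  obtain ⟨γ, h0, h1, h2⟩ := hY.1 _ _ hlt
  refine ⟨γ, h0, h1, h2, ?_⟩
  rintro _ ⟨s, hs, rfl⟩
  refine mem_image_of_between hY hd hab hcont (fun t ht => ?_) ?_
  · by_contra hcon
    have h3 := len t ht
    have h4 : 0 ≤ dist (f t) (f b) := dist_nonneg
    have h5 : f t = f b := dist_eq_zero.1 (by linarith)
    rw [h5] at hcon
    exact hcon hlt
  · have e1 := h2 0 ⟨le_rfl, dist_nonneg⟩ s hs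
    have e2 := h2 s hs _ ⟨dist_nonneg, le_rfl⟩
    rw [h0, zero_sub, abs_neg, abs_of_nonneg hs.1] at e1
    rw [h1, abs_sub_comm, abs_of_nonneg (by linarith [hs.2])] at e2
    rw [e1, e2]
    ring
end
end

section
/- Let Y be a CAT(1) space with geometric dimension 1. Then every locally injective path in Y can be reparametrized to be a locally geodesic path. -/
set_option autoImplicit false

noncomputable section

open Set
open scoped ENNReal

universe u

/-- The cosine of `sphCompAngle a b c`. -/
def sphCompCos (a b c : ℝ) : ℝ :=
  (Real.cos c - Real.cos a * Real.cos b) / (Real.sin a * Real.sin b)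

lemma sphCompCos_swap (a b c : ℝ) : sphCompCos a b c = sphCompCos b a c := by
  unfold sphCompCos
  rw [mul_comm (Real.cos a), mul_comm (Real.sin a)]

lemma sin_pos_of_mem_Ioc {r : ℝ} (h0 : 0 < r) (h1 : r ≤ 1) : 0 < Real.sin r :=
  Real.sin_pos_of_pos_of_lt_pi h0 (by linarith [Real.pi_gt_three])

section

variable {Y : Type u} [MetricSpace Y]

/-- Monotonicity of comparison angles along one side of a triangle. -/
lemma IsCAT1.sphCompCos_anti (hY : IsCAT1 Y) {p z : Y} {g : ℝ → Y} {l r : ℝ}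
    (hg0 : g 0 = p) (hg : ∀ s ∈ Icc 0 l, ∀ t ∈ Icc 0 l, dist (g s) (g t) = |s - t|)
    (hl : l ≤ 1) (hr : 0 < r) (hrl : r ≤ l) (hz0 : 0 < dist z p) (hz1 : dist z p ≤ 1) :
    sphCompCos l (dist z p) (dist z (g l)) ≤ sphCompCos r (dist z p) (dist z (g r)) := by
  have hl0 : 0 < l := hr.trans_le hrl
  have hpl : dist p (g l) = l := by
    rw [← hg0, hg 0 ⟨le_rfl, hl0.le⟩ l ⟨hl0.le, le_rfl⟩, zero_sub, abs_neg, abs_of_pos hl0]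
  have hper : dist z p + dist z (g l) + dist p (g l) < 2 * Real.pi := by
    have := dist_triangle z p (g l)
    linarith [Real.pi_gt_three]
  have h := hY.2 p (g l) z g (by rw [hpl]; exact ⟨hg0, rfl, hg⟩) hper (by rwa [hpl]) r
    (by rw [hpl]; exact ⟨hr.le, hrl⟩)
  rw [hpl] at h
  have hsl := sin_pos_of_mem_Ioc hl0 hl
  have hsr := sin_pos_of_mem_Ioc hr (hrl.trans hl)
  have hsz := sin_pos_of_mem_Ioc hz0 hz1
  rw [Real.sin_sub, div_le_iff₀ hsl] at h
  unfold sphCompCos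
  rw [div_le_div_iff₀ (by positivity) (by positivity)]
  nlinarith [mul_le_mul_of_nonneg_left h hsz.le]

lemma GermSeg.dist_eq {p : Y} (g : GermSeg (fun x y : Y => edist x y) p) :
    ∀ s ∈ Icc 0 g.1.2, ∀ t ∈ Icc 0 g.1.2, dist (g.1.1 s) (g.1.1 t) = |s - t| := by
  intro s hs t ht
  have h := g.2.2.2 s hs t ht
  simp only [edist_dist] at h
  rwa [ENNReal.ofReal_eq_ofReal_iff dist_nonneg (abs_nonneg _)] at h

lemma GermSeg.dist_base {p : Y} (g : GermSeg (fun x y : Y => edist x y) p) {s : ℝ}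
    (hs : s ∈ Icc 0 g.1.2) : dist (g.1.1 s) p = s := by
  have h := g.dist_eq s hs 0 ⟨le_rfl, g.2.1.le⟩
  rwa [g.2.2.1, sub_zero, abs_of_nonneg hs.1] at h

lemma linkDist_le_sphCompAngle {p : Y} (g h : GermSeg (fun x y : Y => edist x y) p) {s t : ℝ}
    (hs : s ∈ Ioc (0 : ℝ) (min g.1.2 1)) (ht : t ∈ Ioc (0 : ℝ) (min h.1.2 1)) :
    linkDist _ p g h ≤ ENNReal.ofReal (sphCompAngle s t (dist (g.1.1 s) (h.1.1 t))) := by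
  unfold linkDist
  apply ENNReal.ofReal_le_ofReal
  refine (ciInf_le ⟨0, ?_⟩ ⟨s, hs⟩).trans ((ciInf_le ⟨0, ?_⟩ ⟨t, ht⟩).trans_eq ?_)
  · rintro _ ⟨x, rfl⟩
    exact Real.iInf_nonneg fun _ => Real.arccos_nonneg _
  · rintro _ ⟨x, rfl⟩
    exact Real.arccos_nonneg _
  · simp [edist_dist]

/-- Two maps into `Y` are tangent at `0` from the right. -/
def Tangent (g h : ℝ → Y) : Prop :=
  ∀ ε > (0 : ℝ), ∀ᶠ r in nhdsWithin (0 : ℝ) (Ioi 0), dist (g r) (h r) ≤ ε * r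

lemma Tangent.symm {g h : ℝ → Y} (H : Tangent g h) : Tangent h g := by
  intro ε hε
  simpa only [dist_comm] using H ε hε

lemma Tangent.trans {g h k : ℝ → Y} (H : Tangent g h) (K : Tangent h k) : Tangent g k := by
  intro ε hε
  filter_upwards [H (ε / 2) (by positivity), K (ε / 2) (by positivity)] with r h1 h2
  linarith [dist_triangle (g r) (h r) (k r)]

lemma IsCAT1.tangent_of_linkDist_eq_zero (hY : IsCAT1 Y) {p : Y}
    {g h : GermSeg (fun x y : Y => edist x y) p} (H : linkDist _ p g h = 0) :
    Tangent g.1.1 h.1.1 := by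
  intro ε hε
  have : Nonempty (Ioc (0 : ℝ) (min g.1.2 1)) := ⟨⟨_, lt_min g.2.1 one_pos, le_rfl⟩⟩
  have : Nonempty (Ioc (0 : ℝ) (min h.1.2 1)) := ⟨⟨_, lt_min h.2.1 one_pos, le_rfl⟩⟩
  have hpi := Real.pi_gt_three
  set η : ℝ := 2 / Real.pi ^ 2 * ε ^ 2 with hη
  have hη0 : 0 < η := by positivity
  have hα : 0 < Real.arccos (1 - η) := Real.arccos_pos.2 (by linarith)
  obtain ⟨⟨s, hs⟩, hs'⟩ := exists_lt_of_ciInf_lt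
    ((ENNReal.ofReal_eq_zero.1 H).trans_lt hα)
  obtain ⟨⟨t, ht⟩, ht'⟩ := exists_lt_of_ciInf_lt hs'
  simp only [edist_dist, ENNReal.toReal_ofReal dist_nonneg] at ht'
  have hK : 1 - η < sphCompCos s t (dist (g.1.1 s) (h.1.1 t)) := by
    by_contra! hc
    exact (Real.arccos_le_arccos hc).not_gt ht'
  have hsg := le_min_iff.1 hs.2
  have hth := le_min_iff.1 ht.2
  filter_upwards [Ioc_mem_nhdsGT (lt_min hs.1 ht.1)] with r hr
  have hrs := hr.2.trans (min_le_left _ _)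
  have hrt := hr.2.trans (min_le_right _ _)
  have isoG : ∀ x ∈ Icc 0 s, ∀ y ∈ Icc 0 s, dist (g.1.1 x) (g.1.1 y) = |x - y| :=
    fun x hx y hy => g.dist_eq x ⟨hx.1, hx.2.trans hsg.1⟩ y ⟨hy.1, hy.2.trans hsg.1⟩
  have isoH : ∀ x ∈ Icc 0 t, ∀ y ∈ Icc 0 t, dist (h.1.1 x) (h.1.1 y) = |x - y| :=
    fun x hx y hy => h.dist_eq x ⟨hx.1, hx.2.trans hth.1⟩ y ⟨hy.1, hy.2.trans hth.1⟩
  have dht : dist (h.1.1 t) p = t := h.dist_base ⟨ht.1.le, hth.1⟩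
  have dgr : dist (g.1.1 r) p = r := g.dist_base ⟨hr.1.le, hrs.trans hsg.1⟩
  have h1 := hY.sphCompCos_anti (z := h.1.1 t) g.2.2.1 isoG hsg.2 hr.1 hrs
    (by rw [dht]; exact ht.1) (by rw [dht]; exact hth.2)
  have h2 := hY.sphCompCos_anti (z := g.1.1 r) h.2.2.1 isoH hth.2 hr.1 hrt
    (by rw [dgr]; exact hr.1) (by rw [dgr]; exact hrs.trans hsg.2)
  rw [dht, dist_comm _ (g.1.1 s), dist_comm _ (g.1.1 r)] at h1
  rw [dgr, sphCompCos_swap] at h2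
  have h3 := hK.trans_le (h1.trans h2)
  have hsr := sin_pos_of_mem_Ioc hr.1 (hrs.trans hsg.2)
  have hd : dist (g.1.1 r) (h.1.1 r) ≤ Real.pi := by
    have dhr : dist (h.1.1 r) p = r := h.dist_base ⟨hr.1.le, hrt.trans hth.1⟩
    linarith [dist_triangle_right (g.1.1 r) (h.1.1 r) p]
  have hq := Real.cos_le_one_sub_mul_cos_sq (x := dist (g.1.1 r) (h.1.1 r))
    (by rwa [abs_of_nonneg dist_nonneg])
  unfold sphCompCos at h3
  rw [lt_div_iff₀ (by positivity)] at h3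
  have hsin : Real.sin r ^ 2 ≤ r ^ 2 := by
    have := Real.sin_lt hr.1
    gcongr
  have h4 : 2 / Real.pi ^ 2 * dist (g.1.1 r) (h.1.1 r) ^ 2 ≤ 2 / Real.pi ^ 2 * (ε * r) ^ 2 := by
    nlinarith [Real.sin_sq_add_cos_sq r, mul_le_mul_of_nonneg_left hsin hη0.le]
  have h5 := le_of_mul_le_mul_left h4 (by positivity)
  exact le_of_sq_le_sq h5 (by have := hr.1; positivity)

/-- In dimension one, the germs of geodesics from `p` to points of a connected set that avoids `p`
are pairwise tangent. -/
lemma IsCAT1.tangent_of_isPreconnected (hY : IsCAT1 Y) {p : Y}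
    (hdisc : CauchyDiscrete (linkDist (fun x y : Y => edist x y) p)) {S : Set Y}
    (hS : IsPreconnected S) (hpS : p ∉ S) (hball : ∀ x ∈ S, dist p x < 1)
    {γ : Y → ℝ → Y} (hγ0 : ∀ x ∈ S, γ x 0 = p) (hγ1 : ∀ x ∈ S, γ x (dist p x) = x)
    (hγ : ∀ x ∈ S, ∀ s ∈ Icc 0 (dist p x), ∀ t ∈ Icc 0 (dist p x),
      dist (γ x s) (γ x t) = |s - t|) {x y : Y} (hx : x ∈ S) (hy : y ∈ S) :
    Tangent (γ x) (γ y) := by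
  have hpos : ∀ x ∈ S, 0 < dist p x := fun x hx => dist_pos.2 fun h => hpS (h ▸ hx)
  let G : S → GermSeg (fun x y : Y => edist x y) p := fun x =>
    ⟨(γ x, dist p x), hpos x x.2, hγ0 x x.2, fun s hs t ht => by
      show edist (γ x s) (γ x t) = _
      rw [edist_dist, hγ x x.2 s hs t ht]⟩
  have hle : ∀ x y : S, linkDist _ p (G x) (G y) ≤
      ENNReal.ofReal (sphCompAngle (dist p x) (dist p y) (dist (x : Y) y)) := by
    intro x y
    have := linkDist_le_sphCompAngle (G x) (G y) (s := dist p x) (t := dist p y)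
      ⟨hpos x x.2, le_min le_rfl (hball x x.2).le⟩ ⟨hpos y y.2, le_min le_rfl (hball y y.2).le⟩
    simpa only [G, hγ1 x x.2, hγ1 y y.2] using this
  refine hS.induction₂ (fun x y => Tangent (γ x) (γ y)) ?_
    (fun _ _ _ _ _ _ h k => h.trans k) (fun _ _ _ _ h => h.symm) hx hy
  intro x hx
  by_contra hcon
  have hfr : ∃ᶠ y in nhdsWithin x S, ¬ Tangent (γ x) (γ y) := by
    rwa [Filter.not_eventually] at hcon
  obtain ⟨v, hv, hvt⟩ := Filter.exists_seq_forall_of_frequently hfr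
  have hvS : ∀ᶠ n in Filter.atTop, v n ∈ S := hv.eventually self_mem_nhdsWithin
  obtain ⟨N₀, hN₀⟩ := Filter.eventually_atTop.1 hvS
  -- interleave the sequence with its limit
  let w : ℕ → S := fun n => if Even n then ⟨x, hx⟩ else ⟨v (n + N₀), hN₀ _ (Nat.le_add_left _ _)⟩
  have hw : Filter.Tendsto (fun n => (w n : Y)) Filter.atTop (nhds x) := by
    have hv' : Filter.Tendsto (fun n => v (n + N₀)) Filter.atTop (nhds x) :=
      (Filter.tendsto_add_atTop_iff_nat N₀).2 (tendsto_nhds_of_tendsto_nhdsWithin hv)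
    rw [Metric.tendsto_atTop] at hv' ⊢
    intro ε hε
    obtain ⟨N, hN⟩ := hv' ε hε
    refine ⟨N, fun n hn => ?_⟩
    by_cases he : Even n
    · simpa [w, he] using hε
    · simpa [w, he] using hN n hn
  have hsin : Real.sin (dist p x) ≠ 0 := (sin_pos_of_mem_Ioc (hpos x hx) (hball x hx).le).ne'
  have hcont : ContinuousAt (fun q : Y × Y => sphCompAngle (dist p q.1) (dist p q.2)
      (dist q.1 q.2)) (x, x) := by
    unfold sphCompAngle
    refine Real.continuous_arccos.continuousAt.comp (ContinuousAt.div ?_ ?_ (mul_ne_zero hsin hsin))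
    · fun_prop
    · fun_prop
  have hval : sphCompAngle (dist p x) (dist p x) (dist x x) = 0 := by
    unfold sphCompAngle
    rw [Real.arccos_eq_zero, dist_self, Real.cos_zero, le_div_iff₀ (mul_self_pos.2 hsin)]
    nlinarith [Real.sin_sq_add_cos_sq (dist p x)]
  have hlim : Filter.Tendsto (fun q : ℕ × ℕ => sphCompAngle (dist p (w q.1)) (dist p (w q.2))
      (dist (w q.1 : Y) (w q.2))) Filter.atTop (nhds 0) := by
    have h := hcont.tendsto
    simp only [hval] at h
    refine h.comp (g := fun q : Y × Y => sphCompAngle (dist p q.1) (dist p q.2) (dist q.1 q.2))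
      (f := fun q : ℕ × ℕ => ((w q.1 : Y), (w q.2 : Y))) ?_
    rw [← Filter.prod_atTop_atTop_eq, nhds_prod_eq]
    exact hw.prodMap hw
  obtain ⟨N, hN⟩ := hdisc (fun n => G (w n)) (by
    intro ε hε
    have hlim' := ENNReal.tendsto_ofReal hlim
    rw [ENNReal.ofReal_zero] at hlim'
    obtain ⟨⟨N, M⟩, hN⟩ := Filter.eventually_atTop.1 (hlim'.eventually_lt_const hε)
    refine ⟨max N M, fun m hm n hn => (hle _ _).trans_lt (hN (m, n) ?_)⟩
    exact ⟨(le_max_left _ _).trans hm, (le_max_right _ _).trans hn⟩)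
  have h0 := hY.tangent_of_linkDist_eq_zero (hN (2 * N) (by omega) (2 * N + 1) (by omega))
  have e1 : Even (2 * N) := even_two_mul N
  have e2 : ¬ Even (2 * N + 1) := by simp
  simp only [G, w, e1, e2, if_true, if_false] at h0
  exact hvt _ h0

/-- In dimension one, a small connected set contains every point between two of its points. -/
lemma IsCAT1.mem_of_dist_add_dist (hY : IsCAT1 Y) {p : Y}
    (hdisc : CauchyDiscrete (linkDist (fun x y : Y => edist x y) p)) {S : Set Y}
    (hS : IsPreconnected S) {x y : Y} (hx : x ∈ S) (hy : y ∈ S)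
    (hsmall : ∀ z ∈ S, dist x z < 1 / 4) (hp : dist x p + dist p y = dist x y) : p ∈ S := by
  by_contra hpS
  have hball : ∀ z ∈ S, dist p z < 1 := by
    intro z hz
    have := dist_triangle p x z
    rw [dist_comm p x] at this
    linarith [hsmall z hz, hsmall y hy, dist_nonneg (x := p) (y := y)]
  have hex : ∀ z, ∃ γ : ℝ → Y, z ∈ S → γ 0 = p ∧ γ (dist p z) = z ∧
      ∀ s ∈ Icc 0 (dist p z), ∀ t ∈ Icc 0 (dist p z), dist (γ s) (γ t) = |s - t| := by
    intro z
    by_cases hz : z ∈ S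
    · obtain ⟨γ, h⟩ := hY.1 p z ((hball z hz).trans (by linarith [Real.pi_gt_three]))
      exact ⟨γ, fun _ => h⟩
    · exact ⟨fun _ => p, fun h => absurd h hz⟩
  choose γ hγ using hex
  have hT := hY.tangent_of_isPreconnected hdisc hS hpS hball (fun z hz => (hγ z hz).1)
    (fun z hz => (hγ z hz).2.1) (fun z hz => (hγ z hz).2.2) hx hy
  have hpx : 0 < dist p x := dist_pos.2 fun h => hpS (h ▸ hx)
  have hpy : 0 < dist p y := dist_pos.2 fun h => hpS (h ▸ hy)
  obtain ⟨r, hr, hrm⟩ := ((hT 1 one_pos).and (Ioc_mem_nhdsGT (lt_min hpx hpy))).exists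
  have hrx := hrm.2.trans (min_le_left _ _)
  have hry := hrm.2.trans (min_le_right _ _)
  have h1 := (hγ x hx).2.2 _ ⟨hpx.le, le_rfl⟩ r ⟨hrm.1.le, hrx⟩
  have h2 := (hγ y hy).2.2 r ⟨hrm.1.le, hry⟩ _ ⟨hpy.le, le_rfl⟩
  rw [(hγ x hx).2.1, abs_of_nonneg (by linarith)] at h1
  rw [(hγ y hy).2.1, abs_of_nonpos (by linarith)] at h2
  have h3 := dist_triangle4 x (γ x r) (γ y r) y
  rw [dist_comm x p] at hp
  linarith [hrm.1]

/-- In dimension one, a short injective path has its points in metric order. -/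
lemma IsCAT1.dist_add_dist_of_injOn (hY : IsCAT1 Y)
    (hdisc : ∀ p, CauchyDiscrete (linkDist (fun x y : Y => edist x y) p)) {f : ℝ → Y} {s r t : ℝ}
    (hsr : s ≤ r) (hrt : r ≤ t) (hf : ContinuousOn f (Icc s t)) (hinj : InjOn f (Icc s t))
    (hsmall : ∀ u ∈ Icc s t, dist (f s) (f u) < 1 / 4) :
    dist (f s) (f r) + dist (f r) (f t) = dist (f s) (f t) := by
  have hst := hsr.trans hrt
  obtain ⟨γ, hγ0, hγ1, hγ⟩ := hY.1 (f s) (f t)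
    ((hsmall t ⟨hst, le_rfl⟩).trans (by linarith [Real.pi_gt_three]))
  set L := dist (f s) (f t) with hL
  have hL0 : 0 ≤ L := dist_nonneg
  have hbetween : ∀ q ∈ Icc 0 L, dist (f s) (γ q) + dist (γ q) (f t) = L := by
    intro q hq
    rw [← hγ0, ← hγ1, hγ 0 ⟨le_rfl, hL0⟩ q hq, hγ q hq L ⟨hL0, le_rfl⟩, zero_sub, abs_neg,
      abs_of_nonneg hq.1, abs_of_nonpos (by linarith [hq.2])]
    ring
  have hγc : ContinuousOn γ (Icc 0 L) := by
    refine (LipschitzOnWith.of_dist_le_mul (K := 1) fun u hu v hv => ?_).continuousOn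
    rw [hγ u hu v hv, Real.dist_eq, NNReal.coe_one, one_mul]
  have hsub : γ '' Icc 0 L ⊆ f '' Icc s r ∪ f '' Icc r t := by
    rintro _ ⟨q, hq, rfl⟩
    rw [← image_union, Icc_union_Icc_eq_Icc hsr hrt]
    exact hY.mem_of_dist_add_dist (hdisc _) (isPreconnected_Icc.image f hf)
      (mem_image_of_mem f ⟨le_rfl, hst⟩) (mem_image_of_mem f ⟨hst, le_rfl⟩)
      (by rintro _ ⟨u, hu, rfl⟩; exact hsmall u hu) (hbetween q hq)
  have hleft : Icc s r ⊆ Icc s t := Icc_subset_Icc_right hrt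
  have hright : Icc r t ⊆ Icc s t := Icc_subset_Icc_left hsr
  obtain ⟨_, ⟨q, hq, rfl⟩, ⟨u, hu, hu'⟩, ⟨v, hv, hv'⟩⟩ :=
    isPreconnected_closed_iff.1 (isPreconnected_Icc.image γ hγc) _ _
      (isCompact_Icc.image_of_continuousOn (hf.mono hleft)).isClosed
      (isCompact_Icc.image_of_continuousOn (hf.mono hright)).isClosed hsub
      ⟨f s, ⟨0, ⟨le_rfl, hL0⟩, hγ0⟩, ⟨s, ⟨le_rfl, hsr⟩, rfl⟩⟩
      ⟨f t, ⟨L, ⟨hL0, le_rfl⟩, hγ1⟩, ⟨t, ⟨hrt, le_rfl⟩, rfl⟩⟩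
  have huv := hinj (hleft hu) (hright hv) (hu'.trans hv'.symm)
  have hur : u = r := le_antisymm hu.2 (huv ▸ hv.1)
  rw [← hur, hu']
  exact hbetween q hq

/-- A path whose short pieces have their points in metric order has an arclength function. -/
lemma exists_arclength {f : ℝ → Y} {a b δ : ℝ} (hδ : 0 < δ)
    (hadd : ∀ s r t, a ≤ s → s ≤ r → r ≤ t → t ≤ b → t - s ≤ δ →
      dist (f s) (f r) + dist (f r) (f t) = dist (f s) (f t))
    (hne : ∀ s t, a ≤ s → s < t → t ≤ b → t - s ≤ δ → f s ≠ f t) :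
    ∃ l : ℝ → ℝ, StrictMonoOn l (Icc a b) ∧
      ∀ s t, a ≤ s → s ≤ t → t ≤ b → t - s ≤ δ → l t - l s = dist (f s) (f t) := by
  have key : ∀ n : ℕ, ∀ c ≤ b, c ≤ a + n * δ → ∃ l : ℝ → ℝ, StrictMonoOn l (Icc a c) ∧
      ∀ s t, a ≤ s → s ≤ t → t ≤ c → t - s ≤ δ → l t - l s = dist (f s) (f t) := by
    intro n
    induction n with
    | zero =>
      intro c _ hc
      rw [Nat.cast_zero, zero_mul, add_zero] at hc
      refine ⟨fun _ => 0, fun s hs t ht hst => by linarith [hs.1, ht.2], fun s t hs hst ht _ => ?_⟩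
      rw [le_antisymm hst (by linarith), dist_self, sub_zero]
    | succ n ih =>
      intro c hcb hc
      push_cast at hc
      rcases le_or_gt c a with hca | hac
      · refine ⟨fun _ => 0, fun s hs t ht hst => by linarith [hs.1, ht.2], fun s t hs hst ht _ => ?_⟩
        rw [le_antisymm hst (by linarith), dist_self, sub_zero]
      obtain ⟨e, hae, hec, hce, hen⟩ : ∃ e, a ≤ e ∧ e ≤ c ∧ c - e ≤ δ ∧ e ≤ a + n * δ :=
        ⟨max a (c - δ), le_max_left _ _, max_le hac.le (by linarith),
          by linarith [le_max_right a (c - δ)], max_le (le_add_of_nonneg_right (by positivity))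
            (by linarith)⟩
      obtain ⟨l, hmono, hl⟩ := ih e (hec.trans hcb) hen
      refine ⟨fun t => if t ≤ e then l t else l e + dist (f e) (f t), ?_, ?_⟩
      · intro s hs t ht hst
        by_cases hte : t ≤ e
        · have hse := hst.le.trans hte
          simpa only [hte, hse, if_true] using hmono ⟨hs.1, hse⟩ ⟨ht.1, hte⟩ hst
        · have het := not_le.1 hte
          by_cases hse : s ≤ e
          · simp only [hte, hse, if_true, if_false]
            have h1 := hmono.monotoneOn ⟨hs.1, hse⟩ ⟨hae, le_rfl⟩ hse
            have h2 := dist_pos.2 (hne e t hae het (ht.2.trans hcb) (by linarith [ht.2]))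
            linarith
          · simp only [hte, hse, if_false]
            have h1 := hadd e s t hae (not_le.1 hse).le hst.le (ht.2.trans hcb)
              (by linarith [ht.2])
            have h2 := dist_pos.2 (hne s t hs.1 hst (ht.2.trans hcb)
              (by linarith [ht.2, not_le.1 hse]))
            linarith
      · intro s t hs hst ht hd
        by_cases hte : t ≤ e
        · have hse := hst.trans hte
          simpa only [hte, hse, if_true] using hl s t hs hst hte hd
        · have het := not_le.1 hte
          by_cases hse : s ≤ e
          · simp only [hte, hse, if_true, if_false]
            have h1 := hl s e hs hse le_rfl (by linarith)
            have h2 := hadd s e t hs hse het.le (ht.trans hcb) hd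
            linarith
          · simp only [hte, hse, if_false]
            have h1 := hadd e s t hae (not_le.1 hse).le hst (ht.trans hcb) (by linarith)
            linarith
  obtain ⟨n, hn⟩ := exists_nat_ge ((b - a) / δ)
  rw [div_le_iff₀ hδ] at hn
  exact key n b le_rfl (by linarith)

end

/-- locally injective paths.  Let `Y` be a CAT(1) space of
geometric dimension one.  Every locally injective (continuous) path in `Y` can be
reparametrized, by a monotone continuous surjective change of parameter, to be a
locally geodesic path. -/
theorem locally_injective_reparametrize
    {Y : Type u} [MetricSpace Y] (hY : IsCAT1 Y)
    (hdim : dimEq 1 Y (fun x y : Y => edist x y))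
    (f : ℝ → Y) (a b : ℝ) (hab : a ≤ b)
    (hcont : ContinuousOn f (Set.Icc a b))
    (hinj : ∀ t ∈ Set.Icc a b, ∃ ε > (0:ℝ),
      Set.InjOn f (Set.Icc a b ∩ Set.Icc (t - ε) (t + ε))) :
    ∃ (c d : ℝ) (φ : ℝ → ℝ), c ≤ d ∧
      ContinuousOn φ (Set.Icc c d) ∧ MonotoneOn φ (Set.Icc c d) ∧
      φ c = a ∧ φ d = b ∧ φ '' Set.Icc c d = Set.Icc a b ∧
      ∀ t ∈ Set.Icc c d, ∃ ε > (0:ℝ),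
        ∀ s ∈ Set.Icc c d ∩ Set.Icc (t - ε) (t + ε),
        ∀ u ∈ Set.Icc c d ∩ Set.Icc (t - ε) (t + ε),
          dist (f (φ s)) (f (φ u)) = |s - u| := by
  have hdisc : ∀ p, CauchyDiscrete (linkDist (fun x y : Y => edist x y) p) := hdim.1
  obtain ⟨δ, hδ, hshort⟩ : ∃ δ > 0, ∀ s t, a ≤ s → s ≤ t → t ≤ b → t - s ≤ δ →
      InjOn f (Icc s t) ∧ ∀ u ∈ Icc s t, dist (f s) (f u) < 1 / 4 := by
    obtain ⟨δ₁, hδ₁, h₁⟩ := Metric.uniformContinuousOn_iff.1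
      (isCompact_Icc.uniformContinuousOn_of_continuous hcont) (1 / 4) (by norm_num)
    choose! ε hε hεinj using hinj
    obtain ⟨δ₂, hδ₂, h₂⟩ := lebesgue_number_lemma_of_metric (isCompact_Icc (a := a) (b := b))
      (c := fun i : Icc a b => Metric.ball (i : ℝ) (ε i)) (fun _ => Metric.isOpen_ball)
      (fun x hx => mem_iUnion.2 ⟨⟨x, hx⟩, Metric.mem_ball_self (hε x hx)⟩)
    refine ⟨min δ₁ δ₂ / 2, by positivity, fun s t hs hst ht hd => ⟨?_, fun u hu => ?_⟩⟩
    · obtain ⟨i, hi⟩ := h₂ s ⟨hs, hst.trans ht⟩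
      refine InjOn.mono (fun x hx => ?_) (hεinj i i.2)
      refine ⟨⟨hs.trans hx.1, hx.2.trans ht⟩, ?_⟩
      have hxs : x ∈ Metric.ball s δ₂ := by
        rw [Metric.mem_ball, Real.dist_eq, abs_of_nonneg (by linarith [hx.1])]
        linarith [hx.2, min_le_right δ₁ δ₂]
      have := hi hxs
      rw [Real.ball_eq_Ioo] at this
      exact Ioo_subset_Icc_self this
    · refine h₁ s ⟨hs, hst.trans ht⟩ u ⟨hs.trans hu.1, hu.2.trans ht⟩ ?_
      rw [Real.dist_eq, abs_of_nonpos (by linarith [hu.1])]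
      linarith [hu.2, min_le_left δ₁ δ₂]
  obtain ⟨l, hmono, hl⟩ := exists_arclength (f := f) (a := a) (b := b) hδ
    (fun s r t hs hsr hrt ht hd => by
      obtain ⟨hi, hsm⟩ := hshort s t hs (hsr.trans hrt) ht hd
      exact hY.dist_add_dist_of_injOn hdisc hsr hrt (hcont.mono (Icc_subset_Icc hs ht)) hi hsm)
    (fun s t hs hst ht hd hf => hst.ne
      ((hshort s t hs hst.le ht hd).1 (left_mem_Icc.2 hst.le) (right_mem_Icc.2 hst.le) hf))
  have hdist : ∀ s ∈ Icc a b, ∀ t ∈ Icc a b, |s - t| ≤ δ → dist (f s) (f t) = |l s - l t| := by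
    intro s hs t ht hd
    wlog hst : s ≤ t generalizing s t
    · rw [dist_comm, abs_sub_comm]
      exact this t ht s hs (by rwa [abs_sub_comm]) (le_of_not_ge hst)
    rw [abs_of_nonpos (sub_nonpos.2 hst)] at hd
    rw [abs_of_nonpos (sub_nonpos.2 (hmono.monotoneOn hs ht hst)),
      ← hl s t hs.1 hst ht.2 (by linarith), neg_sub]
  have hlc : ContinuousOn l (Icc a b) := by
    rw [Metric.continuousOn_iff]
    intro t ht ε hε
    obtain ⟨η, hη, h⟩ := Metric.continuousOn_iff.1 hcont t ht ε hε
    refine ⟨min η δ, by positivity, fun s hs hst => ?_⟩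
    rw [Real.dist_eq, ← hdist s hs t ht (hst.le.trans (min_le_right _ _))]
    exact h s hs (hst.trans_le (min_le_left _ _))
  have ha : a ∈ Icc a b := ⟨le_rfl, hab⟩
  have hb : b ∈ Icc a b := ⟨hab, le_rfl⟩
  have hmaps : ∀ x ∈ Icc a b, l x ∈ Icc (l a) (l b) := fun x hx =>
    ⟨hmono.monotoneOn ha hx hx.1, hmono.monotoneOn hx hb hx.2⟩
  have hsurj : ∀ y ∈ Icc (l a) (l b), ∃ x ∈ Icc a b, l x = y := intermediate_value_Icc hab hlc
  choose! φ hφ hlφ using hsurj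
  have hφl : ∀ x ∈ Icc a b, φ (l x) = x := fun x hx =>
    hmono.injOn (hφ _ (hmaps x hx)) hx (hlφ _ (hmaps x hx))
  have hφmono : MonotoneOn φ (Icc (l a) (l b)) := fun s hs t ht hst =>
    (hmono.le_iff_le (hφ s hs) (hφ t ht)).1 (by rwa [hlφ s hs, hlφ t ht])
  have hφc : ContinuousOn φ (Icc (l a) (l b)) := by
    have hc : Continuous (fun y : Icc (l a) (l b) => (⟨φ y, hφ y y.2⟩ : Icc a b)) :=
      Monotone.continuous_of_surjective (fun x y hxy => hφmono x.2 y.2 hxy)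
        fun x => ⟨⟨l x, hmaps x x.2⟩, Subtype.ext (hφl x x.2)⟩
    exact continuousOn_iff_continuous_domRestrict.2 (continuous_subtype_val.comp hc)
  refine ⟨l a, l b, φ, (hmaps a ha).2, hφc, hφmono, hφl a ha, hφl b hb, ?_, fun t ht => ?_⟩
  · exact (MapsTo.image_subset hφ).antisymm fun x hx => ⟨l x, hmaps x hx, hφl x hx⟩
  · obtain ⟨η, hη, h⟩ := Metric.continuousOn_iff.1 hφc t ht (δ / 2) (by positivity)
    refine ⟨η / 2, by positivity, fun s hs u hu => ?_⟩
    have hclose : ∀ v ∈ Icc (l a) (l b) ∩ Icc (t - η / 2) (t + η / 2),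
        dist (φ v) (φ t) < δ / 2 := fun v hv => by
      refine h v hv.1 ?_
      rw [Real.dist_eq, abs_lt]
      constructor <;> linarith [hv.2.1, hv.2.2]
    rw [hdist _ (hφ s hs.1) _ (hφ u hu.1), hlφ s hs.1, hlφ u hu.1]
    rw [← Real.dist_eq]
    linarith [dist_triangle_right (φ s) (φ u) (φ t), hclose s hs, hclose u hu]
end
end
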